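/- arXiv:1309.5488 — 6 statements merged into one kernel-verified Lean document; each statement's English description precedes it below -/
import Mathlib

section
/- Consider the state-reversion model with n ≥ 3 nodes and weights α, β > 0 satisfying α + β ≤ 1/(n−1). Then for every time t and every realization of the arc set E_t and of B_t, D_t ∈ {0,1}, the maximum absolute state is non-increasing: M(t+1) ≤ M(t). -/
open MeasureTheory ProbabilityTheory Filter Topology

noncomputable section

/-- Positive in-neighbors of node `i`: nodes `j` such that the arc `(j,i)` is present
(indicator `Aset`) and has positive sign. -/
def Npos {n : ℕ} (Aset sgn : Fin n × Fin n → Bool) (i : Fin n) : Finset (Fin n) :=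
  Finset.univ.filter fun j => Aset (j, i) = true ∧ sgn (j, i) = true

/-- Negative in-neighbors of node `i`. -/
def Nneg {n : ℕ} (Aset sgn : Fin n × Fin n → Bool) (i : Fin n) : Finset (Fin n) :=
  Finset.univ.filter fun j => Aset (j, i) = true ∧ sgn (j, i) = false

/-- `{0,1}`-valued coercion of a Bernoulli variable. -/
def b01 (x : Bool) : ℝ := if x then 1 else 0

/-- One step of the state-reversion model: `x` is the state at time `t`, `x'` at `t+1`. -/
def SRupdate {n : ℕ} (α β : ℝ) (Aset sgn : Fin n × Fin n → Bool)
    (Bt Dt : Bool) (x x' : Fin n → ℝ) : Prop :=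
  ∀ i, x' i = x i
    + α * b01 Bt * (-(∑ j ∈ Npos Aset sgn i, (x i - x j)))
    + β * b01 Dt * (-(∑ j ∈ Nneg Aset sgn i, (x i + x j)))

/-- One step of the relative-state-reversion model. -/
def RSRupdate {n : ℕ} (α β : ℝ) (Aset sgn : Fin n × Fin n → Bool)
    (Bt Dt : Bool) (x x' : Fin n → ℝ) : Prop :=
  ∀ i, x' i = x i
    + α * b01 Bt * (-(∑ j ∈ Npos Aset sgn i, (x i - x j)))
    + β * b01 Dt * (∑ j ∈ Nneg Aset sgn i, (x i - x j))

/-- `M(t) = max_i |s_i(t)|`. -/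
def Mmax {n : ℕ} (x : Fin n → ℝ) : ℝ := ⨆ i, |x i|

/-- `max_{i,j} |s_i(t) - s_j(t)|`. -/
def gap {n : ℕ} (x : Fin n → ℝ) : ℝ := ⨆ p : Fin n × Fin n, |x p.1 - x p.2|

theorem b01_nonneg (b : Bool) : 0 ≤ b01 b := by
  cases b <;> simp [b01]

theorem b01_le_one (b : Bool) : b01 b ≤ 1 := by
  cases b <;> simp [b01]

/-- Without self-loops, a node has at most `n - 1` in-neighbors of any kind. -/
theorem card_le_of_notMem {n : ℕ} {s : Finset (Fin n)} {i : Fin n} (hi : i ∉ s) :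
    (s.card : ℝ) ≤ (n : ℝ) - 1 := by
  have h : s.card < n := by
    simpa using Finset.card_lt_univ_of_notMem hi
  have h' : (s.card : ℝ) + 1 ≤ n := by exact_mod_cast h
  linarith

theorem abs_state_reversion_le {ι : Type*} (P N : Finset ι) (y : ι → ℝ) {z c d m : ℝ}
    (hc : 0 ≤ c) (hd : 0 ≤ d) (hcd : c * P.card + d * N.card ≤ 1)
    (hz : |z| ≤ m) (hy : ∀ j, |y j| ≤ m) :
    |z + c * (-(∑ j ∈ P, (z - y j))) + d * (-(∑ j ∈ N, (z + y j)))| ≤ m := by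
  obtain ⟨hz₁, hz₂⟩ := abs_le.mp hz
  have hP₁ : P.card * (z - m) ≤ ∑ j ∈ P, (z - y j) := by
    rw [← nsmul_eq_mul]
    exact Finset.card_nsmul_le_sum _ _ _ fun j _ => by linarith [(abs_le.mp (hy j)).2]
  have hP₂ : ∑ j ∈ P, (z - y j) ≤ P.card * (z + m) := by
    rw [← nsmul_eq_mul]
    exact Finset.sum_le_card_nsmul _ _ _ fun j _ => by linarith [(abs_le.mp (hy j)).1]
  have hN₁ : N.card * (z - m) ≤ ∑ j ∈ N, (z + y j) := by
    rw [← nsmul_eq_mul]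
    exact Finset.card_nsmul_le_sum _ _ _ fun j _ => by linarith [(abs_le.mp (hy j)).1]
  have hN₂ : ∑ j ∈ N, (z + y j) ≤ N.card * (z + m) := by
    rw [← nsmul_eq_mul]
    exact Finset.sum_le_card_nsmul _ _ _ fun j _ => by linarith [(abs_le.mp (hy j)).2]
  rw [abs_le]
  constructor
  · linarith [mul_le_mul_of_nonneg_left hP₂ hc, mul_le_mul_of_nonneg_left hN₂ hd,
      mul_nonneg (sub_nonneg.mpr hcd) (show 0 ≤ z + m by linarith)]
  · linarith [mul_le_mul_of_nonneg_left hP₁ hc, mul_le_mul_of_nonneg_left hN₁ hd,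
      mul_nonneg (sub_nonneg.mpr hcd) (show 0 ≤ m - z by linarith)]

/-- Lemma 1: in the state-reversion model with `α + β ≤ 1/(n-1)`, the
maximum absolute state is non-increasing along one step, for every realization. -/
theorem stmt0 {n : ℕ} (hn : 3 ≤ n)
    (α β : ℝ) (hα : 0 < α) (hβ : 0 < β) (hαβ : α + β ≤ 1 / ((n : ℝ) - 1))
    (Aset sgn : Fin n × Fin n → Bool)
    (hsimple : ∀ i : Fin n, Aset (i, i) = false)
    (Bt Dt : Bool) (x x' : Fin n → ℝ)
    (hupd : SRupdate α β Aset sgn Bt Dt x x') :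
    Mmax x' ≤ Mmax x := by
  have hx : ∀ j, |x j| ≤ Mmax x := fun j => le_ciSup (f := fun j => |x j|)
    (Set.finite_range _).bddAbove j
  have : Nonempty (Fin n) := ⟨⟨0, by omega⟩⟩
  refine ciSup_le fun i => ?_
  have hn1 : 0 < (n : ℝ) - 1 := by
    have : (3 : ℝ) ≤ n := by exact_mod_cast hn
    linarith
  have hweights : (α + β) * ((n : ℝ) - 1) ≤ 1 := (le_div_iff₀ hn1).mp hαβ
  have hpos : ((Npos Aset sgn i).card : ℝ) ≤ (n : ℝ) - 1 :=
    card_le_of_notMem (i := i) (by simp [Npos, hsimple])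
  have hneg : ((Nneg Aset sgn i).card : ℝ) ≤ (n : ℝ) - 1 :=
    card_le_of_notMem (i := i) (by simp [Nneg, hsimple])
  rw [hupd i]
  refine abs_state_reversion_le _ _ x (mul_nonneg hα.le (b01_nonneg Bt))
    (mul_nonneg hβ.le (b01_nonneg Dt)) ?_ (hx i) hx
  calc α * b01 Bt * (Npos Aset sgn i).card + β * b01 Dt * (Nneg Aset sgn i).card
      ≤ α * ((n : ℝ) - 1) + β * ((n : ℝ) - 1) :=
        add_le_add
          (mul_le_mul (mul_le_of_le_one_right hα.le (b01_le_one Bt)) hpos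
            (Nat.cast_nonneg _) hα.le)
          (mul_le_mul (mul_le_of_le_one_right hβ.le (b01_le_one Dt)) hneg
            (Nat.cast_nonneg _) hβ.le)
    _ ≤ 1 := by linarith
end
end

section
/- Consider the state-reversion model with n ≥ 3 nodes and weights α, β > 0 satisfying α + β ≤ 1/(n−1). Let i ∈ V and suppose |s_i(t)| ≤ ζ₀ M(t) for some 0 < ζ₀ < 1. Then for every k = 0,1,2,…, and every realization of the arc sets and of B_τ, D_τ ∈ {0,1} for τ ≥ t, one has |s_i(t+k)| ≤ (1 − (1−ζ₀) γ_*^k) M(t), where γ_* = 1 − (α+β)(n−1). -/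
open MeasureTheory ProbabilityTheory Filter Topology

noncomputable section

theorem card_filter_arc_le {n : ℕ} (hn : 1 ≤ n) (E : Fin n × Fin n → Bool) (i : Fin n)
    (hE : E (i, i) = false) (p : Fin n → Prop) [DecidablePred p] :
    ((Finset.univ.filter fun j => E (j, i) = true ∧ p j).card : ℝ) ≤ (n : ℝ) - 1 := by
  have hsub : (Finset.univ.filter fun j => E (j, i) = true ∧ p j) ⊆ Finset.univ.erase i := by
    intro j hj
    refine Finset.mem_erase.2 ⟨?_, Finset.mem_univ j⟩
    rintro rfl
    simp [hE] at hj
  have hcard := Finset.card_le_card hsub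
  rw [Finset.card_erase_of_mem (Finset.mem_univ i), Finset.card_univ, Fintype.card_fin] at hcard
  rw [← Nat.cast_one, ← Nat.cast_sub hn]
  exact_mod_cast hcard

theorem abs_sum_le_card_mul {ι : Type*} (S : Finset ι) (x : ι → ℝ) (K : ℝ)
    (hx : ∀ j, |x j| ≤ K) : |∑ j ∈ S, x j| ≤ S.card * K := by
  simpa using (Finset.abs_sum_le_sum_abs x S).trans (Finset.sum_le_card_nsmul S _ K fun j _ => hx j)

/-- In one step of the state-reversion model, `|x i|` moves at most a fraction
`(α + β) (n - 1)` of the way towards a common bound `K` of the absolute values. -/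
theorem SRupdate.abs_le {n : ℕ} (hn : 1 ≤ n) {α β : ℝ} (hα : 0 ≤ α) (hβ : 0 ≤ β)
    (hαβ : (α + β) * ((n : ℝ) - 1) ≤ 1) {E sgn : Fin n × Fin n → Bool} {b d : Bool}
    {x x' : Fin n → ℝ} (h : SRupdate α β E sgn b d x x') {i : Fin n} (hE : E (i, i) = false)
    {K : ℝ} (hx : ∀ j, |x j| ≤ K) :
    |x' i| ≤ |x i| + (α + β) * ((n : ℝ) - 1) * (K - |x i|) := by
  have hP : ((Npos E sgn i).card : ℝ) ≤ (n : ℝ) - 1 := card_filter_arc_le hn E i hE _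
  have hN : ((Nneg E sgn i).card : ℝ) ≤ (n : ℝ) - 1 := card_filter_arc_le hn E i hE _
  have hSP := abs_sum_le_card_mul (Npos E sgn i) x K hx
  have hSN := abs_sum_le_card_mul (Nneg E sgn i) x K hx
  have ha : 0 ≤ α * b01 b := mul_nonneg hα (b01_nonneg b)
  have hd : 0 ≤ β * b01 d := mul_nonneg hβ (b01_nonneg d)
  have hp : α * b01 b * (Npos E sgn i).card ≤ α * ((n : ℝ) - 1) :=
    mul_le_mul (mul_le_of_le_one_right hα (b01_le_one b)) hP (Nat.cast_nonneg _) hα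
  have hq : β * b01 d * (Nneg E sgn i).card ≤ β * ((n : ℝ) - 1) :=
    mul_le_mul (mul_le_of_le_one_right hβ (b01_le_one d)) hN (Nat.cast_nonneg _) hβ
  have hx' := h i
  simp only [Finset.sum_sub_distrib, Finset.sum_add_distrib, Finset.sum_const, nsmul_eq_mul]
    at hx'
  set p := α * b01 b * (Npos E sgn i).card
  set q := β * b01 d * (Nneg E sgn i).card
  have hw : 0 ≤ 1 - p - q := by linarith
  calc |x' i| = |(1 - p - q) * x i + α * b01 b * ∑ j ∈ Npos E sgn i, x j
          - β * b01 d * ∑ j ∈ Nneg E sgn i, x j| := by rw [hx']; congr 1; ring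
    _ ≤ |(1 - p - q) * x i| + |α * b01 b * ∑ j ∈ Npos E sgn i, x j|
          + |β * b01 d * ∑ j ∈ Nneg E sgn i, x j| :=
        (abs_sub _ _).trans (add_le_add_left (abs_add_le _ _) _)
    _ ≤ (1 - p - q) * |x i| + p * K + q * K := by
        rw [abs_mul, abs_mul (α * b01 b), abs_mul (β * b01 d), abs_of_nonneg hw, abs_of_nonneg ha,
          abs_of_nonneg hd]
        have h₁ := mul_le_mul_of_nonneg_left hSP ha
        have h₂ := mul_le_mul_of_nonneg_left hSN hd
        rw [← mul_assoc] at h₁ h₂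
        linarith
    _ = |x i| + (p + q) * (K - |x i|) := by ring
    _ ≤ |x i| + (α + β) * ((n : ℝ) - 1) * (K - |x i|) := by
        have := mul_le_mul_of_nonneg_right
          (show p + q ≤ (α + β) * ((n : ℝ) - 1) by linarith) (sub_nonneg.2 (hx i))
        linarith

/-- Lemma 2: if `|s_i(t)| ≤ ζ₀ M(t)` then
`|s_i(t+k)| ≤ (1 - (1-ζ₀) γ_*^k) M(t)` with `γ_* = 1 - (α+β)(n-1)`,
for every realization of arc sets and of `B`, `D`. -/
theorem stmt1 {n : ℕ} (hn : 3 ≤ n)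
    (α β : ℝ) (hα : 0 < α) (hβ : 0 < β) (hαβ : α + β ≤ 1 / ((n : ℝ) - 1))
    (A : ℕ → Fin n × Fin n → Bool) (sgn : ℕ → Fin n × Fin n → Bool)
    (hsimple : ∀ τ (i : Fin n), A τ (i, i) = false)
    (B D : ℕ → Bool) (s : ℕ → Fin n → ℝ)
    (hupd : ∀ τ, SRupdate α β (A τ) (sgn τ) (B τ) (D τ) (s τ) (s (τ + 1)))
    (t : ℕ) (i : Fin n) (ζ₀ : ℝ) (hζ0 : 0 < ζ₀) (hζ1 : ζ₀ < 1)
    (hi : |s t i| ≤ ζ₀ * Mmax (s t)) :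
    ∀ k : ℕ,
      |s (t + k) i| ≤ (1 - (1 - ζ₀) * (1 - (α + β) * ((n : ℝ) - 1)) ^ k) * Mmax (s t) := by
  have hn1 : (0 : ℝ) < (n : ℝ) - 1 := by
    have : (3 : ℝ) ≤ n := by exact_mod_cast hn
    linarith
  have hc : (α + β) * ((n : ℝ) - 1) ≤ 1 := (le_div_iff₀ hn1).1 hαβ
  have hstep := fun τ {j : Fin n} {K : ℝ} =>
    (hupd τ).abs_le (by omega) hα.le hβ.le hc (hsimple τ j) (K := K)
  have hbound : ∀ k j, |s (t + k) j| ≤ Mmax (s t) := by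
    intro k
    induction k with
    | zero => exact fun j => le_ciSup (f := fun i => |s t i|) (Set.finite_range _).bddAbove j
    | succ k ih =>
      intro j
      have h₁ := hstep (t + k) (j := j) ih
      have h₂ := mul_le_of_le_one_left (sub_nonneg.2 (ih j)) hc
      rw [← add_assoc]
      linarith
  intro k
  induction k with
  | zero => simpa using hi
  | succ k ih =>
    have h₁ := hstep (t + k) (j := i) (hbound k)
    have h₂ := mul_le_mul_of_nonneg_left ih (sub_nonneg.2 hc)
    rw [← add_assoc, pow_succ]
    linarith
end
end

section
/- Consider the state-reversion model with n ≥ 3 nodes and weights α, β > 0 satisfying α + β ≤ 1/(n−1). Let i ∈ V with |s_i(t)| ≤ ζ₀ M(t) for some 0 < ζ₀ < 1, and suppose (i,j) ∈ E_t. If B_t = 1 in case the arc (i,j) is positive, and D_t = 1 in case the arc (i,j) is negative, then |s_j(t+1)| ≤ (1 − (1−ζ₀) min{α,β}) M(t). -/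
open MeasureTheory ProbabilityTheory Filter Topology

noncomputable section

theorem abs_le_Mmax {n : ℕ} (x : Fin n → ℝ) (i : Fin n) : |x i| ≤ Mmax x :=
  le_ciSup (f := fun i => |x i|) (Set.finite_range _).bddAbove i

theorem card_le_sub_one_of_notMem {n : ℕ} {S : Finset (Fin n)} {j : Fin n} (hj : j ∉ S) :
    (S.card : ℝ) ≤ (n : ℝ) - 1 := by
  have h : S.card < n := by
    simpa using Finset.card_lt_univ_of_notMem hj
  have h' : (S.card : ℝ) + 1 ≤ n := by exact_mod_cast h
  linarith

theorem abs_sum_le_card_mul_Mmax {n : ℕ} (S : Finset (Fin n)) (x : Fin n → ℝ) :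
    |∑ k ∈ S, x k| ≤ S.card * Mmax x := by
  calc |∑ k ∈ S, x k| ≤ ∑ k ∈ S, |x k| := Finset.abs_sum_le_sum_abs _ _
    _ ≤ S.card • Mmax x := Finset.sum_le_card_nsmul _ _ _ fun k _ => abs_le_Mmax x k
    _ = S.card * Mmax x := nsmul_eq_mul _ _

theorem abs_sum_le_of_mem {n : ℕ} {S : Finset (Fin n)} {x : Fin n → ℝ} {i : Fin n} (hiS : i ∈ S)
    {ζ : ℝ} (hi : |x i| ≤ ζ * Mmax x) :
    |∑ k ∈ S, x k| ≤ S.card * Mmax x - (1 - ζ) * Mmax x := by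
  have hrest := abs_sum_le_card_mul_Mmax (S.erase i) x
  have hcard : ((S.erase i).card : ℝ) + 1 = S.card := by
    exact_mod_cast Finset.card_erase_add_one hiS
  rw [← Finset.sum_erase_add S x hiS]
  calc |∑ k ∈ S.erase i, x k + x i| ≤ |∑ k ∈ S.erase i, x k| + |x i| := abs_add_le _ _
    _ ≤ (S.erase i).card * Mmax x + ζ * Mmax x := add_le_add hrest hi
    _ = S.card * Mmax x - (1 - ζ) * Mmax x := by rw [← hcard]; ring

theorem SRupdate.abs_le_s2 {n : ℕ} {α β : ℝ} (hα : 0 ≤ α) (hβ : 0 ≤ β)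
    (hαβ : (α + β) * ((n : ℝ) - 1) ≤ 1) {Aset sgn : Fin n × Fin n → Bool}
    (hsimple : ∀ i : Fin n, Aset (i, i) = false) {Bt Dt : Bool} {x x' : Fin n → ℝ}
    (hupd : SRupdate α β Aset sgn Bt Dt x x') (j : Fin n) :
    |x' j| ≤ Mmax x
      - α * b01 Bt * ((Npos Aset sgn j).card * Mmax x - |∑ k ∈ Npos Aset sgn j, x k|)
      - β * b01 Dt * ((Nneg Aset sgn j).card * Mmax x - |∑ k ∈ Nneg Aset sgn j, x k|) := by
  have hp := card_le_sub_one_of_notMem (S := Npos Aset sgn j) (j := j) (by simp [Npos, hsimple])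
  have hq := card_le_sub_one_of_notMem (S := Nneg Aset sgn j) (j := j) (by simp [Nneg, hsimple])
  have hx := hupd j
  rw [Finset.sum_sub_distrib, Finset.sum_add_distrib, Finset.sum_const, Finset.sum_const,
    nsmul_eq_mul, nsmul_eq_mul] at hx
  have hA : 0 ≤ α * b01 Bt := mul_nonneg hα (b01_nonneg Bt)
  have hC : 0 ≤ β * b01 Dt := mul_nonneg hβ (b01_nonneg Dt)
  have hA' : α * b01 Bt ≤ α := mul_le_of_le_one_right hα (b01_le_one Bt)
  have hC' : β * b01 Dt ≤ β := mul_le_of_le_one_right hβ (b01_le_one Dt)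
  set A := α * b01 Bt
  set C := β * b01 Dt
  set p := ((Npos Aset sgn j).card : ℝ)
  set q := ((Nneg Aset sgn j).card : ℝ)
  set P := ∑ k ∈ Npos Aset sgn j, x k
  set Q := ∑ k ∈ Nneg Aset sgn j, x k
  have hAp : A * p ≤ α * ((n : ℝ) - 1) := mul_le_mul hA' hp (Nat.cast_nonneg _) hα
  have hCq : C * q ≤ β * ((n : ℝ) - 1) := mul_le_mul hC' hq (Nat.cast_nonneg _) hβ
  have hc : 0 ≤ 1 - A * p - C * q := by linarith
  have hx' : x' j = (1 - A * p - C * q) * x j + A * P - C * Q := by rw [hx]; ring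
  calc |x' j| ≤ |(1 - A * p - C * q) * x j| + |A * P| + |C * Q| := by
        rw [hx']
        exact (abs_sub _ _).trans (add_le_add_left (abs_add_le _ _) _)
    _ = (1 - A * p - C * q) * |x j| + A * |P| + C * |Q| := by
        rw [abs_mul, abs_mul A P, abs_mul C Q, abs_of_nonneg hc, abs_of_nonneg hA, abs_of_nonneg hC]
    _ ≤ (1 - A * p - C * q) * Mmax x + A * |P| + C * |Q| := by
        gcongr
        exact abs_le_Mmax x j
    _ = _ := by ring

/-- Lemma 3: if `|s_i(t)| ≤ ζ₀ M(t)`, the arc `(i,j)` is realized at time `t`,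
`B_t = 1` if this arc is positive and `D_t = 1` if it is negative, then
`|s_j(t+1)| ≤ (1 - (1-ζ₀) min{α,β}) M(t)`. -/
theorem stmt2 {n : ℕ} (hn : 3 ≤ n)
    (α β : ℝ) (hα : 0 < α) (hβ : 0 < β) (hαβ : α + β ≤ 1 / ((n : ℝ) - 1))
    (Aset sgn : Fin n × Fin n → Bool)
    (hsimple : ∀ i : Fin n, Aset (i, i) = false)
    (Bt Dt : Bool) (x x' : Fin n → ℝ)
    (hupd : SRupdate α β Aset sgn Bt Dt x x')
    (i j : Fin n) (ζ₀ : ℝ) (hζ0 : 0 < ζ₀) (hζ1 : ζ₀ < 1)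
    (hi : |x i| ≤ ζ₀ * Mmax x)
    (harc : Aset (i, j) = true)
    (hB : sgn (i, j) = true → Bt = true)
    (hD : sgn (i, j) = false → Dt = true) :
    |x' j| ≤ (1 - (1 - ζ₀) * min α β) * Mmax x := by
  have hn' : (0 : ℝ) < (n : ℝ) - 1 := by
    have : (3 : ℝ) ≤ n := by exact_mod_cast hn
    linarith
  have hM : 0 ≤ Mmax x := (abs_nonneg _).trans (abs_le_Mmax x i)
  have hζM : 0 ≤ (1 - ζ₀) * Mmax x := mul_nonneg (by linarith) hM
  have hmain := hupd.abs_le_s2 hα.le hβ.le ((le_div_iff₀ hn').1 hαβ) hsimple j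
  have hP := abs_sum_le_card_mul_Mmax (Npos Aset sgn j) x
  have hQ := abs_sum_le_card_mul_Mmax (Nneg Aset sgn j) x
  cases hs : sgn (i, j)
  · have hQi := abs_sum_le_of_mem (S := Nneg Aset sgn j) (by simp [Nneg, harc, hs]) hi
    have hPos := mul_nonneg (mul_nonneg hα.le (b01_nonneg Bt)) (sub_nonneg.2 hP)
    have hmin := mul_le_mul_of_nonneg_right (min_le_right α β) hζM
    have hNeg := mul_le_mul_of_nonneg_left (le_sub_comm.1 hQi) hβ.le
    simp only [hD hs, b01, if_true, mul_one] at hmain hPos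
    linarith
  · have hPi := abs_sum_le_of_mem (S := Npos Aset sgn j) (by simp [Npos, harc, hs]) hi
    have hNeg := mul_nonneg (mul_nonneg hβ.le (b01_nonneg Dt)) (sub_nonneg.2 hQ)
    have hmin := mul_le_mul_of_nonneg_right (min_le_left α β) hζM
    have hPos := mul_le_mul_of_nonneg_left (le_sub_comm.1 hPi) hα.le
    simp only [hB hs, b01, if_true, mul_one] at hmain hNeg
    linarith
end
end

section
/- Consider the state-reversion model with n ≥ 3 nodes and weights satisfying α < 1/(2n) and β > 16 n^{n+1}. Then for every time t and every realization of the arc set E_t and of B_t, D_t ∈ {0,1}, one has M(t+1) ≥ M(t)/(2n). -/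
open MeasureTheory ProbabilityTheory Filter Topology

noncomputable section

/-- An increasing sequence of subsets of a finite type that starts nonempty is stationary at some
index below the cardinality of the type. -/
lemma exists_stationary_of_monotone {ι : Type*} [Fintype ι] {S : ℕ → Finset ι}
    (hS : Monotone S) (h0 : (S 0).Nonempty) :
    ∃ k < Fintype.card ι, S (k + 1) ⊆ S k := by
  by_contra! h
  have key : ∀ k ≤ Fintype.card ι, k + 1 ≤ (S k).card := by
    intro k
    induction k with
    | zero => intro _; exact h0.card_pos
    | succ k ih =>
      intro hk
      have hlt : (S k).card < (S (k + 1)).card :=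
        Finset.card_lt_card ⟨hS k.le_succ, h k hk⟩
      have := ih (by omega)
      omega
  have := key _ le_rfl
  have := Finset.card_le_univ (S (Fintype.card ι))
  omega

/-- If `σ * x i` is close to the upper bound `M` and the signed sum of `x i + x j` over `N` is
small, then every `x j` with `j ∈ N` is close to `-σ * M`. -/
lemma le_neg_mul_of_sum_add_le {ι : Type*} [DecidableEq ι] {N : Finset ι} {x : ι → ℝ}
    {M δ ε σ : ℝ} {i j : ι} (hx : ∀ k, -M ≤ σ * x k) (hi : M - δ ≤ σ * x i)
    (hsum : σ * ∑ k ∈ N, (x i + x k) ≤ ε) (hj : j ∈ N) :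
    M - (N.card * δ + ε) ≤ -(σ * x j) := by
  rw [Finset.mul_sum, ← Finset.add_sum_erase _ _ hj] at hsum
  have h1 : (N.erase j).card • (-δ) ≤ ∑ k ∈ N.erase j, σ * (x i + x k) :=
    Finset.card_nsmul_le_sum _ _ _ fun k _ => by linarith [hx k]
  have h2 : ((N.erase j).card : ℝ) + 1 = N.card := by
    exact_mod_cast Finset.card_erase_add_one hj
  rw [nsmul_eq_mul] at h1
  rw [← h2]
  linarith

/-- A node whose state is close to the extreme value `σ * M`, and which is not pulled towards
zero by its negative neighbors, stays away from zero. -/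
lemma mul_update_lower_bound {ι : Type*} {P N : Finset ι} {n : ℕ} {x : ι → ℝ}
    {a b M y σ : ℝ} {i : ι} (hn : 0 < n) (ha0 : 0 ≤ a) (ha : a ≤ 1 / (2 * (n : ℝ)))
    (hb : 0 ≤ b) (hM : 0 ≤ M) (hP : P.card + 1 ≤ n) (hx : ∀ k, |σ * x k| ≤ M)
    (hN : ∀ j ∈ N, σ * (x i + x j) ≤ 0)
    (hy : y = x i + a * (-(∑ j ∈ P, (x i - x j))) + b * (-(∑ j ∈ N, (x i + x j)))) :
    σ * x i - M + M / n ≤ σ * y := by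
  have hn' : (0 : ℝ) < n := by exact_mod_cast hn
  have h1 : σ * ∑ j ∈ P, (x i - x j) ≤ (n - 1) * (2 * M) := by
    rw [Finset.mul_sum]
    have h := Finset.sum_le_card_nsmul P (fun j => σ * (x i - x j)) (2 * M) fun k _ => by
      linarith [(abs_le.1 (hx i)).2, (abs_le.1 (hx k)).1]
    rw [nsmul_eq_mul] at h
    have hP' : (P.card : ℝ) ≤ n - 1 := by
      have : (P.card : ℝ) + 1 ≤ n := by exact_mod_cast hP
      linarith
    exact h.trans (mul_le_mul_of_nonneg_right hP' (by positivity))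
  have h2 : σ * ∑ j ∈ N, (x i + x j) ≤ 0 := by
    rw [Finset.mul_sum]
    exact Finset.sum_nonpos hN
  have hn1 : (0 : ℝ) ≤ n - 1 := by
    have : (1 : ℝ) ≤ n := by exact_mod_cast hn
    linarith
  have h3 : a * (σ * ∑ j ∈ P, (x i - x j)) ≤ M - M / n := calc
    _ ≤ a * ((n - 1) * (2 * M)) := mul_le_mul_of_nonneg_left h1 ha0
    _ ≤ 1 / (2 * (n : ℝ)) * ((n - 1) * (2 * M)) :=
      mul_le_mul_of_nonneg_right ha (by positivity)
    _ = M - M / n := by field_simp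
  have h4 : b * (σ * ∑ j ∈ N, (x i + x j)) ≤ 0 := mul_nonpos_of_nonneg_of_nonpos hb h2
  rw [hy]
  linarith

/-- The sum over negative neighbors is small when the updated state is bounded. -/
lemma abs_sum_add_le {ι : Type*} {P N : Finset ι} {n : ℕ} {x : ι → ℝ}
    {a b M y : ℝ} {i : ι} (hn : 0 < n) (ha0 : 0 ≤ a) (ha : a ≤ 1 / (2 * (n : ℝ)))
    (hb : 0 < b) (hM : 0 ≤ M) (hP : P.card ≤ n) (hx : ∀ k, |x k| ≤ M) (hyM : |y| ≤ M)
    (hy : y = x i + a * (-(∑ j ∈ P, (x i - x j))) + b * (-(∑ j ∈ N, (x i + x j)))) :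
    |∑ j ∈ N, (x i + x j)| ≤ 3 * M / b := by
  have hn' : (0 : ℝ) < n := by exact_mod_cast hn
  have h1 : |∑ j ∈ P, (x i - x j)| ≤ n * (2 * M) := by
    have h := (Finset.abs_sum_le_sum_abs (fun j => x i - x j) P).trans
      (Finset.sum_le_card_nsmul P _ (2 * M) fun k _ => by
        linarith [abs_sub (x i) (x k), hx i, hx k])
    rw [nsmul_eq_mul] at h
    exact h.trans (mul_le_mul_of_nonneg_right (by exact_mod_cast hP) (by positivity))
  have h2 : |a * ∑ j ∈ P, (x i - x j)| ≤ M := by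
    rw [abs_mul, abs_of_nonneg ha0]
    calc _ ≤ 1 / (2 * (n : ℝ)) * (n * (2 * M)) := by gcongr
      _ = M := by field_simp
  have habs : |∑ j ∈ N, (x i + x j)| * b = |(∑ j ∈ N, (x i + x j)) * b| := by
    rw [abs_mul, abs_of_pos hb]
  rw [le_div_iff₀ hb, habs]
  have hxi := abs_le.1 (hx i)
  have hyi := abs_le.1 hyM
  have h2' := abs_le.1 h2
  rw [abs_le]
  constructor <;> linarith

/-- The lower bound on the new maximal state for an arbitrary family of positive and negative
neighborhoods, stated for the extremal value `M` of the old states. -/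
lemma exists_le_abs_update {ι : Type*} [Fintype ι] {n : ℕ} (hcard : Fintype.card ι = n)
    {a b M : ℝ} (ha0 : 0 ≤ a) (ha : a ≤ 1 / (2 * (n : ℝ)))
    (hb : 16 * (n : ℝ) ^ (n + 1) < b) {P N : ι → Finset ι}
    (hP : ∀ i, (P i).card + 1 ≤ n) (hN : ∀ i, (N i).card + 1 ≤ n) {x y : ι → ℝ}
    (hM : 0 < M) (hx : ∀ k, |x k| ≤ M) (hi₀ : ∃ i, |x i| = M)
    (hy : ∀ i, y i = x i + a * (-(∑ j ∈ P i, (x i - x j)))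
      + b * (-(∑ j ∈ N i, (x i + x j)))) :
    ∃ i, M / (2 * (n : ℝ)) ≤ |y i| := by
  classical
  by_contra! hsmall
  obtain ⟨i₀, hi₀⟩ := hi₀
  have hn : 0 < n := by have := hP i₀; omega
  have hn' : (0 : ℝ) < n := by exact_mod_cast hn
  have hn1 : (1 : ℝ) ≤ n := by exact_mod_cast hn
  have hb0 : 0 < b := lt_trans (by positivity) hb
  set ε : ℝ := 3 * M / b with hε
  have hε0 : 0 < ε := by positivity
  have hsum : ∀ i, |∑ j ∈ N i, (x i + x j)| ≤ ε := fun i =>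
    abs_sum_add_le hn ha0 ha hb0 hM.le (by have := hP i; omega) hx
      ((hsmall i).le.trans (div_le_self hM.le (by linarith))) (hy i)
  let S : ℕ → Finset ι := fun k => Finset.univ.filter fun i => M - ε * (n : ℝ) ^ k ≤ |x i|
  have hS : Monotone S := fun k l hkl i hi => by
    simp only [S, Finset.mem_filter, Finset.mem_univ, true_and] at hi ⊢
    have := mul_le_mul_of_nonneg_left (pow_le_pow_right₀ hn1 hkl) hε0.le
    linarith
  have hS0 : ∀ k, i₀ ∈ S k := fun k => by
    simp only [S, Finset.mem_filter, Finset.mem_univ, true_and, hi₀]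
    have : 0 < ε * (n : ℝ) ^ k := by positivity
    linarith
  obtain ⟨k, hk, hstat⟩ := exists_stationary_of_monotone hS ⟨i₀, hS0 0⟩
  rw [hcard] at hk
  obtain ⟨i, hiS, hmin⟩ := Finset.exists_min_image (S k) (fun i => |x i|) ⟨i₀, hS0 k⟩
  have hi : M - ε * (n : ℝ) ^ k ≤ |x i| := by simpa [S] using hiS
  have hδ : ε * (n : ℝ) ^ (k + 1) ≤ M / (2 * n) := by
    have h1 : (n : ℝ) ^ (k + 1) ≤ (n : ℝ) ^ n := pow_le_pow_right₀ hn1 hk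
    calc ε * (n : ℝ) ^ (k + 1) ≤ ε * (n : ℝ) ^ n := mul_le_mul_of_nonneg_left h1 hε0.le
      _ ≤ M / (2 * n) := by
        rw [hε, div_mul_eq_mul_div, div_le_div_iff₀ hb0 (by positivity)]
        have h2 : (n : ℝ) ^ n * n * 16 ≤ b := by rw [← pow_succ]; linarith
        have h3 := mul_le_mul_of_nonneg_left h2 hM.le
        have h4 : 0 ≤ M * ((n : ℝ) ^ n * n) := by positivity
        linarith
  obtain ⟨σ, hσ, hσx⟩ : ∃ σ : ℝ, |σ| = 1 ∧ σ * x i = |x i| := by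
    rcases le_total 0 (x i) with h | h
    · exact ⟨1, by simp, by simp [abs_of_nonneg h]⟩
    · exact ⟨-1, by simp, by simp [abs_of_nonpos h]⟩
  have hσabs : ∀ z, |σ * z| = |z| := fun z => by rw [abs_mul, hσ, one_mul]
  have hpow : 1 ≤ (n : ℝ) ^ k := one_le_pow₀ hn1
  have hneg : ∀ j ∈ N i, σ * (x i + x j) ≤ 0 := by
    intro j hj
    have hnear := le_neg_mul_of_sum_add_le (σ := σ) (M := M) (δ := ε * (n : ℝ) ^ k) (ε := ε)
      (fun l => (abs_le.1 ((hσabs _).trans_le (hx l))).1) (hi.trans hσx.ge)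
      ((le_abs_self _).trans ((hσabs _).trans_le (hsum i))) hj
    have hcN : ((N i).card : ℝ) ≤ n - 1 := by
      have : ((N i).card : ℝ) + 1 ≤ n := by exact_mod_cast hN i
      linarith
    have h1 : (N i).card * (ε * (n : ℝ) ^ k) + ε ≤ ε * (n : ℝ) ^ (k + 1) := by
      have h2 := mul_le_mul_of_nonneg_right hcN (by positivity : 0 ≤ ε * (n : ℝ) ^ k)
      have h3 := mul_le_mul_of_nonneg_left hpow hε0.le
      rw [pow_succ]
      linarith
    have hjS : j ∈ S k := hstat <| by
      simp only [S, Finset.mem_filter, Finset.mem_univ, true_and]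
      have := neg_le_abs (σ * x j)
      rw [hσabs] at this
      linarith
    have hpos : 0 ≤ -(σ * x j) := by
      have : M / (2 * n) ≤ M := div_le_self hM.le (by linarith)
      linarith
    have habs : |x j| = -(σ * x j) := by rw [← hσabs, ← abs_neg, abs_of_nonneg hpos]
    have := hmin j hjS
    linarith
  have hlow := mul_update_lower_bound hn ha0 ha hb0.le hM.le (hP i)
    (fun l => (hσabs _).trans_le (hx l)) hneg (hy i)
  have hup : σ * y i < M / (2 * n) :=
    (le_abs_self _).trans_lt ((hσabs _).trans_lt (hsmall i))
  have hhalf : M / (n : ℝ) = M / (2 * n) + M / (2 * n) := by field_simp; norm_num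
  have hmono : ε * (n : ℝ) ^ k ≤ ε * (n : ℝ) ^ (k + 1) :=
    mul_le_mul_of_nonneg_left (pow_le_pow_right₀ hn1 k.le_succ) hε0.le
  linarith

/-- Lemma 5: if `α < 1/(2n)` and `β > 16 n^(n+1)`, then
`M(t+1) ≥ M(t)/(2n)` for every realization. -/
theorem stmt4 {n : ℕ} (hn : 3 ≤ n)
    (α β : ℝ) (hα0 : 0 < α) (hα : α < 1 / (2 * (n : ℝ)))
    (hβ : 16 * (n : ℝ) ^ (n + 1) < β)
    (Aset sgn : Fin n × Fin n → Bool)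
    (hsimple : ∀ i : Fin n, Aset (i, i) = false)
    (Bt Dt : Bool) (x x' : Fin n → ℝ)
    (hupd : SRupdate α β Aset sgn Bt Dt x x') :
    Mmax x / (2 * (n : ℝ)) ≤ Mmax x' := by
  have hn0 : 0 < n := by omega
  have : Nonempty (Fin n) := ⟨⟨0, hn0⟩⟩
  have hle : ∀ z : Fin n → ℝ, ∀ i, |z i| ≤ Mmax z := fun z i =>
    le_ciSup (f := fun i => |z i|) (Set.finite_range _).bddAbove i
  obtain ⟨i₀, hi₀⟩ : ∃ i, |x i| = Mmax x := exists_eq_ciSup_of_finite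
  have hM : 0 ≤ Mmax x := hi₀ ▸ abs_nonneg _
  rcases hM.eq_or_lt with h0 | hM
  · rw [← h0, zero_div]
    exact (abs_nonneg _).trans (hle x' i₀)
  have hcard : ∀ (T : Finset (Fin n)) (i : Fin n), i ∉ T → T.card + 1 ≤ n := fun T i hi => by
    rw [← Finset.card_insert_of_notMem hi]
    simpa using Finset.card_le_univ (insert i T)
  obtain ⟨i, hi⟩ := exists_le_abs_update (Fintype.card_fin n)
    (P := fun i => if Bt then Npos Aset sgn i else ∅)
    (y := x') (N := fun i => if Dt then Nneg Aset sgn i else ∅) hα0.le hα.le hβ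
    (fun i => hcard _ i (by cases Bt <;> simp [Npos, hsimple]))
    (fun i => hcard _ i (by cases Dt <;> simp [Nneg, hsimple])) hM (hle x) ⟨i₀, hi₀⟩
    (fun i => by rw [hupd i]; cases Bt <;> cases Dt <;> simp [b01])
  exact hi.trans (hle x' i)
end
end

section
/- Let {v_t}_{t≥0} be a sequence of non-negative random variables with E[v₀] < ∞ satisfying, for all t ≥ 0, E[v_{t+1} | v₀,…,v_t] ≤ (1 − ξ_t) v_t + θ_t, where {ξ_t} and {θ_t} are deterministic sequences of non-negative numbers with 0 ≤ ξ_t ≤ 1 for all t, Σ_{t=0}^∞ ξ_t = ∞, Σ_{t=0}^∞ θ_t < ∞, and lim_{t→∞} θ_t/ξ_t = 0. Then lim_{t→∞} v_t = 0 almost surely. -/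
open MeasureTheory ProbabilityTheory Filter Topology

open Finset in
/-- A non-negative sequence `v` whose accumulated balance with non-negative weights `ξ` of divergent
sum and a summable perturbation `θ` converges tends to zero. -/
lemma tendsto_zero_of_tendsto_add_sum {v ξ θ : ℕ → ℝ} {c : ℝ}
    (hv : ∀ t, 0 ≤ v t) (hξ : ∀ t, 0 ≤ ξ t) (hξdiv : ¬ Summable ξ) (hθ : Summable θ)
    (hc : Tendsto (fun t => v t + ∑ k ∈ range t, (ξ k * v k - θ k)) atTop (𝓝 c)) :
    Tendsto v atTop (𝓝 0) := by
  have hθ' := hθ.hasSum.tendsto_sum_nat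
  have hadd : Tendsto (fun t => v t + ∑ k ∈ range t, ξ k * v k) atTop (𝓝 (c + ∑' k, θ k)) := by
    refine (hc.add hθ').congr fun t => ?_
    rw [sum_sub_distrib]
    ring
  obtain ⟨B, hB⟩ := hadd.bddAbove_range
  have hsum : Summable fun k => ξ k * v k :=
    summable_of_sum_range_le (c := B) (fun k => mul_nonneg (hξ k) (hv k)) fun t => by
      linarith [hB (Set.mem_range_self t), hv t]
  obtain ⟨L, hL⟩ : ∃ L, Tendsto v atTop (𝓝 L) :=
    ⟨_, (hadd.sub hsum.hasSum.tendsto_sum_nat).congr fun t => by ring⟩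
  have hL0 : 0 ≤ L := ge_of_tendsto' hL hv
  obtain rfl | hLpos := hL0.eq_or_lt
  · exact hL
  refine (hξdiv ?_).elim
  refine summable_of_isBigO_nat hsum (Asymptotics.IsBigO.of_bound (2 / L) ?_)
  filter_upwards [hL.eventually_const_lt (half_lt_self hLpos)] with k hk
  rw [Real.norm_of_nonneg (hξ k), Real.norm_of_nonneg (mul_nonneg (hξ k) (hv k)), div_mul_eq_mul_div,
    le_div_iff₀ hLpos]
  nlinarith [hξ k]

/-- A non-negative supermartingale converges almost everywhere. -/
lemma MeasureTheory.Supermartingale.exists_ae_tendsto_of_nonneg {Ω : Type*}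
    {m : MeasurableSpace Ω} {μ : Measure Ω} [IsFiniteMeasure μ] {ℱ : Filtration ℕ m}
    {f : ℕ → Ω → ℝ} (hf : Supermartingale f ℱ μ) (hf0 : ∀ n ω, 0 ≤ f n ω) :
    ∀ᵐ ω ∂μ, ∃ c, Tendsto (fun n => f n ω) atTop (𝓝 c) := by
  have hbdd : ∀ n, eLpNorm ((-f) n) 1 μ ≤ (∫ ω, f 0 ω ∂μ).toNNReal := fun n => by
    rw [Pi.neg_apply, eLpNorm_neg, eLpNorm_one_eq_lintegral_enorm,
      ← ofReal_integral_norm_eq_lintegral_enorm (hf.integrable n)]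
    refine ENNReal.ofReal_le_ofReal ?_
    simp_rw [Real.norm_of_nonneg (hf0 n _)]
    simpa using hf.setIntegral_le n.zero_le MeasurableSet.univ
  filter_upwards [hf.neg.exists_ae_tendsto_of_bdd hbdd] with ω ⟨c, hc⟩
  exact ⟨-c, by simpa using hc.neg⟩

open Finset in
/-- A non-negative almost supermartingale with contraction weights `ξ` and summable perturbation `θ`
becomes a supermartingale once the accumulated drift is added. -/
lemma supermartingale_add_sum {Ω : Type*} {m : MeasurableSpace Ω} {μ : Measure Ω}
    [IsFiniteMeasure μ] {ℱ : Filtration ℕ m} {v : ℕ → Ω → ℝ} {ξ θ : ℕ → ℝ}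
    (hadp : StronglyAdapted ℱ v) (hint : ∀ t, Integrable (v t) μ)
    (hcond : ∀ t, μ[v (t + 1) | ℱ t] ≤ᵐ[μ] fun ω => (1 - ξ t) * v t ω + θ t) (C : ℝ) :
    Supermartingale (fun t ω => v t ω + (∑ k ∈ range t, (ξ k * v k ω - θ k) + C)) ℱ μ := by
  have hmeas : ∀ s t, s ≤ t + 1 →
      StronglyMeasurable[ℱ t] fun ω => ∑ k ∈ range s, (ξ k * v k ω - θ k) + C := fun s t hst => by
    refine (Finset.stronglyMeasurable_fun_sum _ fun k hk => ?_).add stronglyMeasurable_const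
    have hkt : k ≤ t := by have := mem_range.1 hk; omega
    exact (((hadp k).mono (ℱ.mono hkt)).const_mul _).sub stronglyMeasurable_const
  have hintsum : ∀ t, Integrable (fun ω => ∑ k ∈ range t, (ξ k * v k ω - θ k) + C) μ := fun t =>
    (integrable_finsetSum _ fun k _ =>
      ((hint k).const_mul _).sub (integrable_const _)).add (integrable_const _)
  refine supermartingale_nat (fun t => (hadp t).add (hmeas t t t.le_succ))
    (fun t => (hint t).add (hintsum t)) fun t => ?_
  have hce := condExp_add (hint (t + 1)) (hintsum (t + 1)) (ℱ t)
  rw [condExp_of_stronglyMeasurable (ℱ.le t) (hmeas (t + 1) t le_rfl) (hintsum (t + 1))] at hce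
  refine hce.le.trans ?_
  filter_upwards [hcond t] with ω hω
  simp only [Pi.add_apply, sum_range_succ]
  linarith

/-- Lemma 7: if `{v_t}` are non-negative random variables with
`E[v₀] < ∞` and `E[v_{t+1} | v₀,…,v_t] ≤ (1-ξ_t) v_t + θ_t` for deterministic
non-negative sequences with `ξ_t ≤ 1`, `Σ ξ_t = ∞`, `Σ θ_t < ∞`, `θ_t/ξ_t → 0`,
then `v_t → 0` almost surely. -/
theorem stmt17 {Ω : Type} [MeasurableSpace Ω] (μ : Measure Ω) [IsProbabilityMeasure μ]
    (v : ℕ → Ω → ℝ) (hvmeas : ∀ t, Measurable (v t))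
    (hvpos : ∀ t ω, 0 ≤ v t ω)
    (hvint : ∀ t, Integrable (v t) μ)
    (ξ θ : ℕ → ℝ)
    (hξ0 : ∀ t, 0 ≤ ξ t) (hξ1 : ∀ t, ξ t ≤ 1) (hθ0 : ∀ t, 0 ≤ θ t)
    (hξdiv : ¬ Summable ξ) (hθsum : Summable θ)
    (hratio : Tendsto (fun t => θ t / ξ t) atTop (𝓝 0))
    (hcond : ∀ t,
      μ[v (t + 1) | ⨆ k ≤ t, MeasurableSpace.comap (v k) inferInstance] ≤ᵐ[μ]
        fun ω => (1 - ξ t) * v t ω + θ t) :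
    ∀ᵐ ω ∂μ, Tendsto (fun t => v t ω) atTop (𝓝 0) := by
  let ℱ := Filtration.natural v fun t => (hvmeas t).stronglyMeasurable
  have hsuper := supermartingale_add_sum (ℱ := ℱ)
    (Filtration.stronglyAdapted_natural fun t => (hvmeas t).stronglyMeasurable)
    hvint hcond (∑' k, θ k)
  have hnonneg : ∀ t ω,
      0 ≤ v t ω + (∑ k ∈ Finset.range t, (ξ k * v k ω - θ k) + ∑' k, θ k) := fun t ω => by
    have hθle := hθsum.sum_le_tsum (Finset.range t) fun k _ => hθ0 k
    have hsum := Finset.sum_nonneg fun k (_ : k ∈ Finset.range t) =>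
      mul_nonneg (hξ0 k) (hvpos k ω)
    rw [Finset.sum_sub_distrib]
    linarith [hvpos t ω]
  filter_upwards [hsuper.exists_ae_tendsto_of_nonneg hnonneg] with ω ⟨c, hc⟩
  refine tendsto_zero_of_tendsto_add_sum (c := c - ∑' k, θ k) (fun t => hvpos t ω) hξ0 hξdiv hθsum ?_
  exact (hc.sub_const _).congr fun t => by ring
end

section
/- (Robbins–Siegmund) Let {v_t}_{t≥0}, {ξ_t}_{t≥0}, {θ_t}_{t≥0} be sequences of non-negative random variables with E[v₀] < ∞, adapted to the filtration 𝓕_t = σ(v₀,…,v_t; ξ₀,…,ξ_t; θ₀,…,θ_t), and satisfying, for all t ≥ 0, E[v_{t+1} | 𝓕_t] ≤ (1 + ξ_t) v_t + θ_t. If Σ_{t=0}^∞ ξ_t < ∞ and Σ_{t=0}^∞ θ_t < ∞ almost surely, then v_t converges almost surely to a non-negative random variable v as t → ∞. -/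
open MeasureTheory ProbabilityTheory Filter Topology

/-- A nonnegative supermartingale converges almost everywhere. -/
theorem nonneg_supermartingale_exists_ae_tendsto {Ω : Type*} {m0 : MeasurableSpace Ω}
    {μ : Measure Ω} [IsFiniteMeasure μ] {ℱ : Filtration ℕ m0} {f : ℕ → Ω → ℝ}
    (hf : Supermartingale f ℱ μ) (hpos : ∀ t ω, 0 ≤ f t ω) :
    ∀ᵐ ω ∂μ, ∃ c, Tendsto (fun t => f t ω) atTop (𝓝 c) := by
  have hbdd : ∀ t, eLpNorm ((-f) t) 1 μ ≤ (∫ ω, f 0 ω ∂μ).toNNReal := by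
    intro t
    have hle : ∫ ω, f t ω ∂μ ≤ ∫ ω, f 0 ω ∂μ := by
      simpa using hf.setIntegral_le (Nat.zero_le t) MeasurableSet.univ
    rw [Pi.neg_apply, eLpNorm_neg, eLpNorm_one_eq_lintegral_enorm]
    calc ∫⁻ ω, ‖f t ω‖ₑ ∂μ = ∫⁻ ω, ENNReal.ofReal (f t ω) ∂μ := by
          simp_rw [Real.enorm_of_nonneg (hpos t _)]
      _ = ENNReal.ofReal (∫ ω, f t ω ∂μ) :=
          (ofReal_integral_eq_lintegral_ofReal (hf.integrable t) (ae_of_all _ (hpos t))).symm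
      _ ≤ _ := ENNReal.ofReal_le_ofReal hle
  filter_upwards [hf.neg.exists_ae_tendsto_of_bdd hbdd] with ω ⟨c, hc⟩
  exact ⟨-c, by simpa using hc.neg⟩

/-- The Robbins–Siegmund theorem for processes adapted to an arbitrary filtration. -/
theorem robbins_siegmund {Ω : Type*} {m0 : MeasurableSpace Ω} {μ : Measure Ω}
    [IsFiniteMeasure μ] {ℱ : Filtration ℕ m0} {v ξ θ : ℕ → Ω → ℝ}
    (hv : ∀ t, Measurable[ℱ t] (v t)) (hξ : ∀ t, Measurable[ℱ t] (ξ t))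
    (hθ : ∀ t, Measurable[ℱ t] (θ t))
    (hvpos : ∀ t ω, 0 ≤ v t ω) (hξpos : ∀ t ω, 0 ≤ ξ t ω) (hθpos : ∀ t ω, 0 ≤ θ t ω)
    (hvint : ∀ t, Integrable (v t) μ)
    (hcond : ∀ t, μ[v (t + 1) | ℱ t] ≤ᵐ[μ] fun ω => (1 + ξ t ω) * v t ω + θ t ω)
    (hξsum : ∀ᵐ ω ∂μ, Summable (fun t => ξ t ω))
    (hθsum : ∀ᵐ ω ∂μ, Summable (fun t => θ t ω)) :
    ∀ᵐ ω ∂μ, ∃ c : ℝ, 0 ≤ c ∧ Tendsto (fun t => v t ω) atTop (𝓝 c) := by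
  set P : ℕ → Ω → ℝ := fun t ω => ∏ k ∈ Finset.range t, (1 + ξ k ω) with hP
  set S : ℕ → Ω → ℝ := fun t ω => ∑ k ∈ Finset.range t, θ k ω / P (k + 1) ω with hS
  have hP1 : ∀ t ω, 1 ≤ P t ω := fun t ω =>
    Finset.one_le_prod fun k _ => le_add_of_nonneg_right (hξpos k ω)
  have hPpos : ∀ t ω, 0 < P t ω := fun t ω => one_pos.trans_le (hP1 t ω)
  have hPsucc : ∀ t ω, P (t + 1) ω = P t ω * (1 + ξ t ω) := fun t ω =>
    Finset.prod_range_succ _ _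
  have hSsucc : ∀ t ω, S (t + 1) ω = S t ω + θ t ω / P (t + 1) ω := fun t ω =>
    Finset.sum_range_succ _ _
  have hterm : ∀ t ω, 0 ≤ θ t ω / P (t + 1) ω := fun t ω =>
    div_nonneg (hθpos t ω) (hPpos _ ω).le
  have hS0 : ∀ t ω, 0 ≤ S t ω := fun t ω => Finset.sum_nonneg fun k _ => hterm k ω
  have hPmeas : ∀ t s, t ≤ s + 1 → Measurable[ℱ s] (P t) := fun t s hts =>
    Finset.measurable_fun_prod _ fun k hk => by
      have hk' : k ≤ s := by have := Finset.mem_range.1 hk; omega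
      exact ((hξ k).mono (ℱ.mono hk') le_rfl).const_add 1
  have hSmeas : ∀ t s, t ≤ s + 1 → Measurable[ℱ s] (S t) := fun t s hts =>
    Finset.measurable_fun_sum _ fun k hk => by
      have hk' : k ≤ s := by have := Finset.mem_range.1 hk; omega
      exact ((hθ k).mono (ℱ.mono hk') le_rfl).div (hPmeas _ _ (by omega))
  have key : ∀ N : ℕ, ∀ᵐ ω ∂μ, ∃ c, Tendsto (fun t =>
      (if S t ω ≤ N then (P t ω)⁻¹ else 0) * v t ω + (if S t ω ≤ N then N - S t ω else 0))
      atTop (𝓝 c) := by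
    intro N
    set C : ℕ → Ω → ℝ := fun t ω => if S t ω ≤ N then (P t ω)⁻¹ else 0 with hC
    set D : ℕ → Ω → ℝ := fun t ω => if S t ω ≤ N then N - S t ω else 0 with hD
    have hCmeas : ∀ t s, t ≤ s + 1 → Measurable[ℱ s] (C t) := fun t s hts =>
      Measurable.ite (measurableSet_le (hSmeas t s hts) measurable_const)
        (hPmeas t s hts).inv measurable_const
    have hDmeas : ∀ t s, t ≤ s + 1 → Measurable[ℱ s] (D t) := fun t s hts =>
      Measurable.ite (measurableSet_le (hSmeas t s hts) measurable_const)
        ((hSmeas t s hts).const_sub _) measurable_const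
    have hC0 : ∀ t ω, 0 ≤ C t ω := by
      intro t ω
      simp only [hC]
      split_ifs
      exacts [inv_nonneg.2 (hPpos t ω).le, le_rfl]
    have hC1 : ∀ t ω, C t ω ≤ 1 := by
      intro t ω
      simp only [hC]
      split_ifs
      exacts [inv_le_one_of_one_le₀ (hP1 t ω), zero_le_one]
    have hD0 : ∀ t ω, 0 ≤ D t ω := by
      intro t ω
      simp only [hD]
      split_ifs with h
      exacts [sub_nonneg.2 h, le_rfl]
    have hDN : ∀ t ω, D t ω ≤ N := by
      intro t ω
      simp only [hD]
      split_ifs with h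
      exacts [by linarith [hS0 t ω], N.cast_nonneg]
    have hCv : ∀ t s, Integrable (C t * v s) μ := fun t s =>
      (hvint s).bdd_mul (c := 1) ((hCmeas t t (by omega)).mono (ℱ.le t) le_rfl).aestronglyMeasurable
        (ae_of_all _ fun ω => by rw [Real.norm_of_nonneg (hC0 t ω)]; exact hC1 t ω)
    have hDint : ∀ t, Integrable (D t) μ := fun t =>
      Integrable.of_bound ((hDmeas t t (by omega)).mono (ℱ.le t) le_rfl).aestronglyMeasurable N
        (ae_of_all _ fun ω => by rw [Real.norm_of_nonneg (hD0 t ω)]; exact hDN t ω)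
    refine nonneg_supermartingale_exists_ae_tendsto (ℱ := ℱ) (f := fun t => C t * v t + D t)
      (supermartingale_nat (fun t => ?_) (fun t => (hCv t t).add (hDint t)) fun t => ?_)
      fun t ω => add_nonneg (mul_nonneg (hC0 t ω) (hvpos t ω)) (hD0 t ω)
    · exact (((hCmeas t t (by omega)).mul (hv t)).add (hDmeas t t (by omega))).stronglyMeasurable
    · have hpull := condExp_mul_of_stronglyMeasurable_left (m := ℱ t)
        (hCmeas (t + 1) t le_rfl).stronglyMeasurable (hCv (t + 1) (t + 1)) (hvint (t + 1))
      have hDcond := condExp_of_stronglyMeasurable (ℱ.le t)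
        (hDmeas (t + 1) t le_rfl).stronglyMeasurable (hDint (t + 1))
      filter_upwards [condExp_add (hCv (t + 1) (t + 1)) (hDint (t + 1)) (ℱ t), hpull, hcond t]
        with ω h1 h2 h3
      rw [h1, Pi.add_apply, h2, hDcond]
      simp only [Pi.add_apply, Pi.mul_apply]
      by_cases hN : S (t + 1) ω ≤ N
      · have hN' : S t ω ≤ N := by linarith [hSsucc t ω, hterm t ω]
        simp only [hC, hD, if_pos hN, if_pos hN']
        have hmul := mul_le_mul_of_nonneg_left h3 (inv_nonneg.2 (hPpos (t + 1) ω).le)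
        have hξ1 : 1 + ξ t ω ≠ 0 := by linarith [hξpos t ω]
        have heq : (P (t + 1) ω)⁻¹ * ((1 + ξ t ω) * v t ω + θ t ω)
            = (P t ω)⁻¹ * v t ω + θ t ω / P (t + 1) ω := by
          have := (hPpos t ω).ne'
          rw [hPsucc]
          field_simp
        linarith [hSsucc t ω]
      · have hC' : C (t + 1) ω = 0 := if_neg hN
        have hD' : D (t + 1) ω = 0 := if_neg hN
        rw [hC', hD', zero_mul, zero_add]
        exact add_nonneg (mul_nonneg (hC0 t ω) (hvpos t ω)) (hD0 t ω)
  filter_upwards [ae_all_iff.2 key, hξsum, hθsum] with ω hω hξω hθω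
  have hSsum : Summable fun k => θ k ω / P (k + 1) ω :=
    hθω.of_nonneg_of_le (fun k => hterm k ω) fun k => div_le_self (hθpos k ω) (hP1 _ ω)
  have hPlim : Tendsto (fun t => P t ω) atTop (𝓝 (∏' k, (1 + ξ k ω))) :=
    (multipliable_one_add_of_summable hξω.norm).tendsto_prod_tprod_nat
  have hSlim : Tendsto (fun t => S t ω) atTop (𝓝 (∑' k, θ k ω / P (k + 1) ω)) :=
    hSsum.tendsto_sum_tsum_nat
  obtain ⟨N, hN⟩ := exists_nat_ge (∑' k, θ k ω / P (k + 1) ω)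
  have hSN : ∀ t, S t ω ≤ N := fun t =>
    (hSsum.sum_le_tsum _ fun k _ => hterm k ω).trans hN
  obtain ⟨c, hc⟩ := hω N
  simp only [hSN, if_true] at hc
  have hlim : Tendsto (fun t => v t ω) atTop
      (𝓝 ((∏' k, (1 + ξ k ω)) * (c - (N - ∑' k, θ k ω / P (k + 1) ω)))) := by
    refine (hPlim.mul (hc.sub (hSlim.const_sub (N : ℝ)))).congr fun t => ?_
    have := (hPpos t ω).ne'
    field_simp
    ring
  exact ⟨_, ge_of_tendsto' hlim fun t => hvpos t ω, hlim⟩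

/-- Robbins–Siegmund, Lemma 8: if `{v_t}, {ξ_t}, {θ_t}` are
non-negative random variables with `E[v₀] < ∞` and
`E[v_{t+1} | 𝓕_t] ≤ (1+ξ_t) v_t + θ_t`, where
`𝓕_t = σ(v₀,…,v_t; ξ₀,…,ξ_t; θ₀,…,θ_t)`, and `Σ ξ_t < ∞`, `Σ θ_t < ∞` almost
surely, then `v_t` converges almost surely to a non-negative limit. -/
theorem stmt18 {Ω : Type} [MeasurableSpace Ω] (μ : Measure Ω) [IsProbabilityMeasure μ]
    (v ξ θ : ℕ → Ω → ℝ)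
    (hvmeas : ∀ t, Measurable (v t)) (hξmeas : ∀ t, Measurable (ξ t))
    (hθmeas : ∀ t, Measurable (θ t))
    (hvpos : ∀ t ω, 0 ≤ v t ω) (hξpos : ∀ t ω, 0 ≤ ξ t ω) (hθpos : ∀ t ω, 0 ≤ θ t ω)
    (hvint : ∀ t, Integrable (v t) μ)
    (hcond : ∀ t,
      μ[v (t + 1) |
        ⨆ k ≤ t, (MeasurableSpace.comap (v k) inferInstance ⊔
          MeasurableSpace.comap (ξ k) inferInstance ⊔
          MeasurableSpace.comap (θ k) inferInstance)] ≤ᵐ[μ]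
        fun ω => (1 + ξ t ω) * v t ω + θ t ω)
    (hξsum : ∀ᵐ ω ∂μ, Summable (fun t => ξ t ω))
    (hθsum : ∀ᵐ ω ∂μ, Summable (fun t => θ t ω)) :
    ∀ᵐ ω ∂μ, ∃ c : ℝ, 0 ≤ c ∧ Tendsto (fun t => v t ω) atTop (𝓝 c) := by
  have hle : ∀ t, MeasurableSpace.comap (v t) inferInstance ⊔
      MeasurableSpace.comap (ξ t) inferInstance ⊔ MeasurableSpace.comap (θ t) inferInstance ≤
      ⨆ k ≤ t, (MeasurableSpace.comap (v k) inferInstance ⊔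
        MeasurableSpace.comap (ξ k) inferInstance ⊔
        MeasurableSpace.comap (θ k) inferInstance) := fun t =>
    le_iSup₂_of_le t le_rfl le_rfl
  let ℱ : Filtration ℕ ‹MeasurableSpace Ω› :=
    { seq := fun t => ⨆ k ≤ t, (MeasurableSpace.comap (v k) inferInstance ⊔
        MeasurableSpace.comap (ξ k) inferInstance ⊔
        MeasurableSpace.comap (θ k) inferInstance)
      mono' := fun s t hst => biSup_mono fun k hk => hk.trans hst
      le' := fun t => iSup₂_le fun k _ =>
        sup_le (sup_le (hvmeas k).comap_le (hξmeas k).comap_le) (hθmeas k).comap_le }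
  exact robbins_siegmund (ℱ := ℱ)
    (fun t => measurable_iff_comap_le.2 ((le_sup_left.trans le_sup_left).trans (hle t)))
    (fun t => measurable_iff_comap_le.2 ((le_sup_right.trans le_sup_left).trans (hle t)))
    (fun t => measurable_iff_comap_le.2 (le_sup_right.trans (hle t)))
    hvpos hξpos hθpos hvint hcond hξsum hθsum
end
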